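/- Define Φ_ν(q) = ∑_{n=1}^∞ n^ν q^n/(1−q^n) for |q| < 1, Q(q) = 1 + 240·Φ₃(q), and R(q) = 1 − 504·Φ₅(q). Then Φ₁₃(q) = (1 − Q(q)²·R(q))/24. -/

import Mathlib

/-- Lambert-type Eisenstein series Φ_ν(q) = ∑_{n=1}^∞ n^ν q^n/(1−q^n). -/
noncomputable def Phi (ν : ℕ) (q : ℂ) : ℂ :=
  ∑' n : ℕ, ((n : ℂ) + 1) ^ ν * q ^ (n + 1) / (1 - q ^ (n + 1))

open UpperHalfPlane ModularForm EisensteinSeries MatrixGroups in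
theorem E14_aux (z : ℍ) : E (k := 14) (by norm_num) z = E₄ z ^ 2 * E₆ z := by
  have hr : Module.rank ℂ (ModularForm 𝒮ℒ (14 : ℕ)) = 1 := by
    have := dimension_level_one 14 ⟨7, rfl⟩
    rw [this]
    norm_num [Nat.ModEq]
  let g : ModularForm 𝒮ℒ ((14 : ℕ) : ℤ) := ModularForm.mcast (by norm_num) ((E₄.mul E₄).mul E₆)
  have hg : (g : ℍ → ℂ) = (E₄.mul E₄).mul E₆ := rfl
  obtain ⟨c, hc⟩ : ∃ c : ℂ, c • E (k := 14) (by norm_num) = g :=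
    (finrank_eq_one_iff_of_nonzero' _ (E_ne_zero (by norm_num) ⟨7, rfl⟩)).mp
      (Module.rank_eq_one_iff_finrank_eq_one.mp hr) g
  have hq : c • qExpansion 1 (E (k := 14) (by norm_num)) =
      qExpansion 1 E₄ * qExpansion 1 E₄ * qExpansion 1 E₆ := by
    rw [← ModularForm.qExpansion_mul one_pos one_mem_strictPeriods_SL E₄ E₄,
      ← ModularForm.qExpansion_mul one_pos one_mem_strictPeriods_SL (E₄.mul E₄) E₆, ← hg, ← hc,
      ← ModularForm.qExpansion_smul one_pos one_mem_strictPeriods_SL c (E (k := 14) (by norm_num))]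
    rfl
  have h0 := congrArg (PowerSeries.coeff 0) hq
  have h4 := E_qExpansion_coeff_zero (k := 4) (by norm_num) ⟨2, rfl⟩
  have h6 := E_qExpansion_coeff_zero (k := 6) (by norm_num) ⟨3, rfl⟩
  rw [PowerSeries.coeff_smul, E_qExpansion_coeff_zero (k := 14) (by norm_num) ⟨7, rfl⟩,
    PowerSeries.coeff_zero_eq_constantCoeff_apply, map_mul, map_mul,
    ← PowerSeries.coeff_zero_eq_constantCoeff_apply,
    ← PowerSeries.coeff_zero_eq_constantCoeff_apply, h4, h6] at h0
  have hc1 : c = 1 := by simpa using h0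
  have := congrArg (fun f : ModularForm 𝒮ℒ ((14 : ℕ) : ℤ) => f z) hc
  simp only [hc1, one_smul] at this
  rw [this, pow_two]
  rfl

theorem Phi_eq_sigma (ν : ℕ) (q : ℂ) (hq : ‖q‖ < 1) :
    Phi ν q = ∑' n : ℕ+, (ArithmeticFunction.sigma ν n : ℂ) * q ^ (n : ℕ) := by
  rw [← tsum_pow_div_one_sub_eq_tsum_sigma hq,
    tsum_pnat_eq_tsum_succ (f := fun n : ℕ ↦ (n : ℂ) ^ ν * q ^ n / (1 - q ^ n))]
  simp [Phi]

open UpperHalfPlane ModularForm EisensteinSeries in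
theorem E_eq_Phi {k : ℕ} (hk : 3 ≤ k) (hk2 : Even k) (z : ℍ) :
    E hk z = 1 - (2 * k / bernoulli k) * Phi (k - 1) (Complex.exp (2 * Real.pi * Complex.I * z)) := by
  rw [q_expansion_bernoulli hk hk2, Phi_eq_sigma _ _ (norm_exp_two_pi_I_lt_one z)]
  simp only [zpow_natCast]

/-- With Q = 1 + 240Φ₃ and R = 1 − 504Φ₅, Φ₁₃ = (1 − Q²R)/24 for |q| < 1. -/
theorem Phi13_eval (q : ℂ) (hq : ‖q‖ < 1) :
    Phi 13 q = (1 - (1 + 240 * Phi 3 q) ^ 2 * (1 - 504 * Phi 5 q)) / 24 := by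
  rcases eq_or_ne q 0 with rfl | h0
  · simp [Phi]
  let z : UpperHalfPlane := ⟨Function.Periodic.invQParam 1 q,
    Function.Periodic.im_invQParam_pos_of_norm_lt_one one_pos hq h0⟩
  have hz : Complex.exp (2 * Real.pi * Complex.I * z) = q := by
    have := Function.Periodic.qParam_right_inv one_ne_zero h0
    simpa [Function.Periodic.qParam] using this
  have h := E14_aux z
  rw [E_eq_Phi _ ⟨7, rfl⟩, E_eq_Phi _ ⟨2, rfl⟩, E_eq_Phi _ ⟨3, rfl⟩, hz,
    show bernoulli 4 = -1 / 30 by decide +kernel, show bernoulli 6 = 1 / 42 by decide +kernel,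
    show bernoulli 14 = 7 / 6 by decide +kernel] at h
  norm_num at h
  linear_combination (-1 / 24) * h
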